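/- Maximum Modulus Principle: Let U ⊆ ℍ be a slice domain and let f : U → ℍ be slice regular. If |f| has a relative maximum at some point p ∈ U (i.e. there is a neighborhood V ⊆ U of p with |f(q)| ≤ |f(p)| for all q ∈ V), then f is constant on U. -/

import Mathlib

open Quaternion
open scoped InnerProductSpace

/-- The sphere `𝕊` of purely imaginary unit quaternions. -/
def QSphere : Set ℍ := {q : ℍ | q ^ 2 = -1}

/-- The complex plane `ℂ_I` through `1` and `I`. -/
def slicePlane (I : ℍ) : Set ℍ := {q : ℍ | ∃ x y : ℝ, q = (x : ℍ) + y • I}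

/-- A real differentiable `f` is (left) slice regular on `U` if on every slice `U ∩ ℂ_I`
it satisfies the Cauchy-Riemann equation `∂f/∂x + I ∂f/∂y = 0`. -/
def SliceRegularOn (f : ℍ → ℍ) (U : Set ℍ) : Prop :=
  DifferentiableOn ℝ f U ∧
    ∀ I ∈ QSphere, ∀ q ∈ U ∩ slicePlane I,
      fderiv ℝ f q 1 + I * fderiv ℝ f q I = 0

/-- A slice domain: a connected open set intersecting the real axis whose
intersection with each complex plane `ℂ_I` is connected. -/
def SliceDomain (U : Set ℍ) : Prop :=
  IsOpen U ∧ IsConnected U ∧ (∃ x : ℝ, (x : ℍ) ∈ U) ∧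
    ∀ I ∈ QSphere, IsPreconnected (U ∩ slicePlane I)

/-- The algebra embedding `x + iy ↦ x + Iy` of `ℂ` onto the slice plane `ℂ_I`. -/
noncomputable def sliceEmb {I : ℍ} (hI : I ∈ QSphere) : ℂ →ₐ[ℝ] ℍ :=
  Complex.liftAux I (by rw [← sq]; exact hI)

theorem sliceEmb_apply {I : ℍ} (hI : I ∈ QSphere) (z : ℂ) :
    sliceEmb hI z = (z.re : ℍ) + z.im • I :=
  Complex.liftAux_apply I _ z

theorem sliceEmb_ofReal {I : ℍ} (hI : I ∈ QSphere) (x : ℝ) :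
    sliceEmb hI (x : ℂ) = (x : ℍ) := by
  simp

theorem re_eq_zero_and_normSq_eq_one {I : ℍ} (hI : I ∈ QSphere) :
    I.re = 0 ∧ normSq I = 1 := by
  have h : I * I = -1 := by rw [← sq]; exact hI
  have h0 := congrArg QuaternionAlgebra.re h
  have h1 := congrArg QuaternionAlgebra.imI h
  have h2 := congrArg QuaternionAlgebra.imJ h
  have h3 := congrArg QuaternionAlgebra.imK h
  simp only [re_mul, imI_mul, imJ_mul, imK_mul, re_neg, imI_neg, imJ_neg, imK_neg, re_one,
    imI_one, imJ_one, imK_one] at h0 h1 h2 h3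
  have hre : I.re = 0 := by
    by_contra hne
    have hi : I.imI = 0 := mul_left_cancel₀ hne (by linarith)
    have hj : I.imJ = 0 := mul_left_cancel₀ hne (by linarith)
    have hk : I.imK = 0 := mul_left_cancel₀ hne (by linarith)
    rw [hi, hj, hk] at h0
    nlinarith [sq_nonneg I.re]
  refine ⟨hre, ?_⟩
  rw [normSq_def', hre]
  rw [hre] at h0
  linarith

theorem norm_sliceEmb {I : ℍ} (hI : I ∈ QSphere) (z : ℂ) : ‖sliceEmb hI z‖ = ‖z‖ := by
  obtain ⟨hre, hn⟩ := re_eq_zero_and_normSq_eq_one hI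
  refine (sq_eq_sq₀ (norm_nonneg _) (norm_nonneg _)).1 ?_
  rw [Complex.sq_norm, Complex.normSq_apply, sq, ← normSq_eq_norm_mul_self, sliceEmb_apply,
    normSq_def']
  rw [normSq_def', hre] at hn
  simp [hre]
  linear_combination z.im ^ 2 * hn

theorem isometry_sliceEmb {I : ℍ} (hI : I ∈ QSphere) : Isometry (sliceEmb hI) :=
  AddMonoidHomClass.isometry_of_norm _ (norm_sliceEmb hI)

theorem image_sliceEmb_preimage {I : ℍ} (hI : I ∈ QSphere) (U : Set ℍ) :
    sliceEmb hI '' (sliceEmb hI ⁻¹' U) = U ∩ slicePlane I := by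
  ext q
  rw [Set.image_preimage_eq_inter_range]
  refine and_congr_right fun _ => ⟨?_, ?_⟩
  · rintro ⟨z, rfl⟩
    exact ⟨z.re, z.im, sliceEmb_apply hI z⟩
  · rintro ⟨x, y, rfl⟩
    exact ⟨⟨x, y⟩, sliceEmb_apply hI _⟩

/-- Every quaternion lies on some slice plane. -/
theorem exists_mem_slicePlane (q : ℍ) : ∃ I ∈ QSphere, q ∈ slicePlane I := by
  by_cases hq : q.im = 0
  · refine ⟨ofComplex Complex.I, ?_, q.re, 0, ?_⟩
    · change ofComplex Complex.I ^ 2 = -1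
      rw [← map_pow, Complex.I_sq, map_neg, map_one]
    · rw [zero_smul, add_zero]
      nth_rewrite 1 [← re_add_im q]
      rw [hq, add_zero]
  · have hn : ‖q.im‖ ≠ 0 := norm_ne_zero_iff.2 hq
    refine ⟨‖q.im‖⁻¹ • q.im, ?_, q.re, ‖q.im‖, ?_⟩
    · have hsq : q.im ^ 2 = -((‖q.im‖ ^ 2 : ℝ) : ℍ) := by
        rw [sq_eq_neg_normSq.2 (re_im q), normSq_eq_norm_mul_self, sq]
      change (‖q.im‖⁻¹ • q.im) ^ 2 = -1
      rw [smul_pow, hsq, smul_neg, ← coe_smul, smul_eq_mul, ← mul_pow, inv_mul_cancel₀ hn]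
      simp
    · rw [smul_inv_smul₀ hn, re_add_im]

/-- The complex structure on `ℍ` given by left multiplication by `I`. -/
noncomputable abbrev sliceNormedSpace {I : ℍ} (hI : I ∈ QSphere) : NormedSpace ℂ ℍ where
  toModule := Module.compHom ℍ (sliceEmb hI).toRingHom
  norm_smul_le z q := by
    change ‖sliceEmb hI z * q‖ ≤ _
    rw [norm_mul, norm_sliceEmb]

/-- A slice regular function restricts to a holomorphic function on each slice. -/
theorem SliceRegularOn.differentiableOn_comp_sliceEmb {f : ℍ → ℍ} {U : Set ℍ}
    (hf : SliceRegularOn f U) (hU : IsOpen U) {I : ℍ} (hI : I ∈ QSphere) :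
    letI := sliceNormedSpace hI
    DifferentiableOn ℂ (f ∘ sliceEmb hI) (sliceEmb hI ⁻¹' U) := by
  let := sliceNormedSpace hI
  intro z hz
  refine DifferentiableAt.differentiableWithinAt ?_
  set D := fderiv ℝ f (sliceEmb hI z) with hD
  have hCR : D 1 + I * D I = 0 :=
    hf.2 I hI _ ⟨hz, z.re, z.im, sliceEmb_apply hI z⟩
  have hDI : D I = I * D 1 := by
    have h : I * I = -1 := by rw [← sq]; exact hI
    have h' := congrArg (I * ·) hCR
    simp only [mul_add, ← mul_assoc, h, neg_mul, one_mul, mul_zero] at h'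
    exact (add_neg_eq_zero.1 h').symm
  have hlin (w : ℂ) : D (sliceEmb hI w) = sliceEmb hI w * D 1 := by
    have hw : sliceEmb hI w = w.re • (1 : ℍ) + w.im • I := by
      rw [sliceEmb_apply, ← coe_mul_eq_smul w.re, mul_one]
    rw [hw, map_add, map_smul, map_smul, hDI, add_mul, smul_mul_assoc, smul_mul_assoc, one_mul]
  have hdiff : HasFDerivAt f D (sliceEmb hI z) :=
    (hf.1.differentiableAt (hU.mem_nhds hz)).hasFDerivAt
  have hcont := (isometry_sliceEmb hI).continuous
  have ho := hdiff.isLittleO.comp_tendsto hcont.continuousAt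
  refine HasDerivAt.differentiableAt (f' := D 1) (hasDerivAt_iff_isLittleO.2 ?_)
  refine (ho.congr_left fun w => ?_).trans_isBigO (Asymptotics.IsBigO.of_bound 1
    (.of_forall fun w => ?_))
  · simp only [Function.comp_apply]
    rw [← map_sub (sliceEmb hI), hlin]
    rfl
  · simp only [Function.comp_apply]
    rw [← map_sub, norm_sliceEmb, one_mul]

/-- The identity principle on a slice. -/
theorem SliceRegularOn.eq_const_of_frequently_eq {f : ℍ → ℍ} {U : Set ℍ}
    (hf : SliceRegularOn f U) (hU : IsOpen U) {I : ℍ} (hI : I ∈ QSphere)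
    (hconn : IsPreconnected (U ∩ slicePlane I)) {z : ℂ} (hz : sliceEmb hI z ∈ U) {c : ℍ}
    (hfreq : ∃ᶠ w in nhdsWithin z {z}ᶜ, f (sliceEmb hI w) = c) :
    ∀ q ∈ U ∩ slicePlane I, f q = c := by
  let := sliceNormedSpace hI
  have hS : IsOpen (sliceEmb hI ⁻¹' U) := hU.preimage (isometry_sliceEmb hI).continuous
  have hSc : IsPreconnected (sliceEmb hI ⁻¹' U) := by
    rwa [← (isometry_sliceEmb hI).isEmbedding.isInducing.isPreconnected_image,
      image_sliceEmb_preimage]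
  have han := (hf.differentiableOn_comp_sliceEmb hU hI).analyticOnNhd hS
  have heq := han.eqOn_of_preconnected_of_frequently_eq (g := fun _ => c)
    analyticOnNhd_const hSc hz hfreq
  intro q hq
  rw [← image_sliceEmb_preimage hI] at hq
  obtain ⟨w, hw, rfl⟩ := hq
  exact heq hw

/-- The maximum modulus principle on a slice, in local form. -/
theorem SliceRegularOn.eventually_eq_of_isLocalMax_norm {f : ℍ → ℍ} {U : Set ℍ}
    (hf : SliceRegularOn f U) (hU : IsOpen U) {I : ℍ} (hI : I ∈ QSphere) {z : ℂ}
    (hz : sliceEmb hI z ∈ U) (hmax : IsLocalMax (norm ∘ f) (sliceEmb hI z)) :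
    ∀ᶠ w in nhds z, f (sliceEmb hI w) = f (sliceEmb hI z) := by
  have hne : ∀ x y : ℍ, ‖x‖ = 1 → ‖y‖ = 1 → x ≠ y → ‖x + y‖ ≠ 2 := by
    intro x y hx hy hxy h
    have hpar := parallelogram_law_with_norm ℝ x y
    rw [hx, hy, h] at hpar
    have hpos := norm_pos_iff.2 (sub_ne_zero.2 hxy)
    nlinarith
  let := sliceNormedSpace hI
  have : @StrictConvexSpace ℝ ℍ _ _ _ NormedSpace.complexToReal :=
    @StrictConvexSpace.of_norm_add_ne_two ℍ _ NormedSpace.complexToReal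
      fun x y hx hy hxy => hne x y hx hy hxy
  have hcont := (isometry_sliceEmb hI).continuous
  have hS : IsOpen (sliceEmb hI ⁻¹' U) := hU.preimage hcont
  have hd := (hf.differentiableOn_comp_sliceEmb hU hI).eventually_differentiableAt
    (hS.mem_nhds hz)
  exact Complex.eventually_eq_of_isLocalMax_norm hd (hmax.comp_continuous hcont.continuousAt)

/-- **Maximum Modulus Principle.** If `f` is slice regular on a slice domain `U` and
`|f|` has a relative maximum at `p ∈ U`, then `f` is constant on `U`. -/
theorem maximum_modulus (U : Set ℍ) (hU : SliceDomain U) (f : ℍ → ℍ)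
    (hf : SliceRegularOn f U) (p : ℍ) (hp : p ∈ U)
    (hmax : ∃ V ∈ nhds p, V ⊆ U ∧ ∀ q ∈ V, ‖f q‖ ≤ ‖f p‖) :
    ∀ q ∈ U, f q = f p := by
  obtain ⟨hopen, -, ⟨x, hx⟩, hconn⟩ := hU
  obtain ⟨V, hV, -, hVmax⟩ := hmax
  have hloc : IsLocalMax (norm ∘ f) p := Filter.mem_of_superset hV hVmax
  obtain ⟨I, hI, a, b, hab⟩ := exists_mem_slicePlane p
  obtain ⟨z, rfl⟩ : ∃ z, sliceEmb hI z = p := ⟨⟨a, b⟩, by rw [sliceEmb_apply, hab]⟩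
  have hsliceI := hf.eq_const_of_frequently_eq hopen hI (hconn I hI) hp
    ((hf.eventually_eq_of_isLocalMax_norm hopen hI hp hloc).filter_mono
      nhdsWithin_le_nhds).frequently
  intro q hq
  obtain ⟨J, hJ, hqJ⟩ := exists_mem_slicePlane q
  refine hf.eq_const_of_frequently_eq hopen hJ (hconn J hJ) (z := (x : ℂ))
    (by rwa [sliceEmb_ofReal]) ?_ q ⟨hq, hqJ⟩
  have hreal : ∀ᶠ t : ℝ in nhdsWithin x {x}ᶜ,
      f (sliceEmb hJ (t : ℂ)) = f (sliceEmb hI z) := by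
    have hmem : ∀ᶠ t : ℝ in nhds x, (t : ℍ) ∈ U :=
      continuous_coe.continuousAt.eventually (hopen.mem_nhds hx)
    filter_upwards [hmem.filter_mono nhdsWithin_le_nhds] with t ht
    rw [sliceEmb_ofReal]
    exact hsliceI _ ⟨ht, t, 0, by simp⟩
  have htend : Filter.Tendsto (fun t : ℝ => (t : ℂ)) (nhdsWithin x {x}ᶜ)
      (nhdsWithin (x : ℂ) {(x : ℂ)}ᶜ) :=
    Complex.continuous_ofReal.continuousAt.continuousWithinAt.tendsto_nhdsWithin
      fun t ht h => ht (Complex.ofReal_injective h)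
  exact htend.frequently hreal.frequently
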